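/- Let a₁, a₂, a₃ be positive integers with a₂² < 3·a₁·a₃ (so that P(z) = a₁z + a₂z² + a₃z³ has two non-real critical points). Then the Julia set J(P) of P : ℂ → ℂ is either connected or totally disconnected. -/

import Mathlib

namespace PolynomialJulia

open Set Filter Topology Polynomial unitInterval

/-- Two continuous lifts of the same map through a polynomial, avoiding critical points, agree on
a preconnected set as soon as they agree at one point. -/
theorem eqOn_of_eval_eqOn {X : Type*} [TopologicalSpace X] (p : ℂ[X]) {s : Set X} {f g : X → ℂ}
    (hs : IsPreconnected s) (hf : ContinuousOn f s) (hg : ContinuousOn g s)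
    (hfg : ∀ x ∈ s, p.eval (f x) = p.eval (g x)) (hp : ∀ x ∈ s, p.derivative.eval (f x) ≠ 0)
    {x₀ : X} (hx₀ : x₀ ∈ s) (h₀ : f x₀ = g x₀) : EqOn f g s := by
  have : PreconnectedSpace s := Subtype.preconnectedSpace hs
  have hf' : Continuous fun x : s => f x := hf.domRestrict
  have hg' : Continuous fun x : s => g x := hg.domRestrict
  have hopen : IsOpen {x : s | f x = g x} := by
    rw [isOpen_iff_mem_nhds]
    intro x hx
    have hx : f x = g x := hx
    have hinj := (p.hasStrictDerivAt (f x)).hasStrictFDerivAt_equiv (hp x x.2)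
    set e := hinj.toOpenPartialHomeomorph with he
    have hsrc : e.source ∈ 𝓝 (f x) :=
      e.open_source.mem_nhds hinj.mem_toOpenPartialHomeomorph_source
    filter_upwards [hf'.continuousAt hsrc, hg'.continuousAt (hx ▸ hsrc)] with y h1 h2
    exact e.injOn h1 h2 (hfg y y.2)
  have := IsClopen.eq_univ ⟨isClosed_eq hf' hg', hopen⟩ ⟨⟨x₀, hx₀⟩, h₀⟩
  intro x hx
  exact this.symm.subset (mem_univ (⟨x, hx⟩ : s))

/-- Every bounded open set on which a polynomial exceeds `R` in norm has a boundary point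
with the same property. -/
theorem exists_frontier_lt_norm_eval (p : ℂ[X]) {R : ℝ} {U : Set ℂ} (hU : Bornology.IsBounded U)
    {z : ℂ} (hz : z ∈ U) (hR : R < ‖p.eval z‖) : ∃ w ∈ frontier U, R < ‖p.eval w‖ := by
  by_contra! h
  exact hR.not_ge <| Complex.norm_le_of_forall_mem_frontier_norm_le hU
    p.differentiable.diffContOnCl h (subset_closure hz)

theorem isPreconnected_norm_gt (ρ : ℝ) (hρ : 0 < ρ) : IsPreconnected {z : ℂ | ρ < ‖z‖} := by
  have : {z : ℂ | ρ < ‖z‖} = Complex.exp '' {s | Real.log ρ < s.re} := by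
    ext z
    constructor
    · intro hz
      have hz : ρ < ‖z‖ := hz
      have h0 : z ≠ 0 := norm_pos_iff.1 (hρ.trans hz)
      exact ⟨Complex.log z, by simpa [Complex.log_re] using Real.log_lt_log hρ hz,
        Complex.exp_log h0⟩
    · rintro ⟨s, hs, rfl⟩
      simpa [Complex.norm_exp] using (Real.log_lt_iff_lt_exp hρ).1 hs
  rw [this]
  exact (convex_halfSpace_re_gt _).isPreconnected.image _ Complex.continuous_exp.continuousOn

/-- If all critical points of `q` satisfy `‖q c‖ ≤ R`, then `{‖q‖ > R}` is parametrized by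
a half-plane through a lift of the exponential. -/
theorem exists_exterior_parametrization (q : ℂ[X]) {R : ℝ} (hR : 0 < R) (hq : 0 < q.degree)
    (hcrit : ∀ c, q.derivative.eval c = 0 → ‖q.eval c‖ ≤ R) :
    ∃ F : ℂ → ℂ, ContinuousOn F {s | Real.log R < s.re} ∧
      (∀ s, Real.log R < s.re → q.eval (F s) = Complex.exp s) ∧
      ∀ z, R < ‖q.eval z‖ → ∃ s, Real.log R < s.re ∧ F s = z := by
  set A : Set ℂ := {s | Real.log R < s.re} with hA
  set V : Set ℂ := {z | R < ‖q.eval z‖} with hV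
  have hAo : IsOpen A := isOpen_lt continuous_const Complex.continuous_re
  have hAc : Convex ℝ A := convex_halfSpace_re_gt _
  have hexp : ∀ s, s ∈ A ↔ R < ‖Complex.exp s‖ := fun s => by
    rw [Complex.norm_exp]; exact Real.log_lt_iff_lt_exp hR
  have hcov : IsCoveringMapOn q.eval {w : ℂ | R < ‖w‖} :=
    q.isCoveringMapOn_eval.mono (by rintro w hw ⟨c, hc, rfl⟩; exact (hcrit c hc).not_gt hw)
  -- every point of `V` lies on a lift
  have key : ∀ z ∈ V, ∃ F : ℂ → ℂ, ContinuousOn F A ∧ (∀ s ∈ A, q.eval (F s) = Complex.exp s) ∧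
      ∃ s ∈ A, F s = z := by
    intro z hz
    have hz0 : q.eval z ≠ 0 := norm_pos_iff.1 (hR.trans hz)
    have hsA : Complex.log (q.eval z) ∈ A := by rw [hexp, Complex.exp_log hz0]; exact hz
    have : ContractibleSpace A := hAc.contractibleSpace ⟨_, hsA⟩
    have : LocallyPathConnectedSpace A := hAo.locallyPathConnectedSpace
    obtain ⟨F, ⟨hF0, hF⟩, -⟩ := hcov.existsUnique_continuousMap_lifts
      (A := A) ⟨fun s => Complex.exp s, by fun_prop⟩ (a₀ := ⟨_, hsA⟩) (e₀ := z)
      (by simp [Complex.exp_log hz0]) (fun s => (hexp s).1 s.2)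
    classical
    have hval : ∀ s (hs : s ∈ A), (if h : s ∈ A then F ⟨s, h⟩ else 0) = F ⟨s, hs⟩ :=
      fun s hs => dif_pos hs
    refine ⟨fun s => if h : s ∈ A then F ⟨s, h⟩ else 0, ?_, ?_, _, hsA, ?_⟩
    · rw [continuousOn_iff_continuous_domRestrict]
      convert F.continuous using 1
      ext s
      exact hval s s.2
    · intro s hs
      simp only [hval s hs]
      exact congrFun hF ⟨s, hs⟩
    · exact (hval _ hsA).trans hF0
  have hopen : ∀ F : ℂ → ℂ, ContinuousOn F A → (∀ s ∈ A, q.eval (F s) = Complex.exp s) →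
      IsOpen (F '' A) := by
    intro F hFc hF
    rw [isOpen_iff_mem_nhds]
    rintro _ ⟨s, hs, rfl⟩
    have hd : q.derivative.eval (F s) ≠ 0 := fun h0 => by
      have := hcrit _ h0
      rw [hF s hs] at this
      exact this.not_gt ((hexp s).1 hs)
    have hinj := (q.hasStrictDerivAt (F s)).hasStrictFDerivAt_equiv hd
    set e := hinj.toOpenPartialHomeomorph with he
    have hsrc : e.source ∈ 𝓝 (F s) :=
      e.open_source.mem_nhds hinj.mem_toOpenPartialHomeomorph_source
    have hM : A ∩ F ⁻¹' e.source ∈ 𝓝 s :=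
      inter_mem (hAo.mem_nhds hs) ((hFc.continuousAt (hAo.mem_nhds hs)) hsrc)
    have hM' : Complex.exp '' (A ∩ F ⁻¹' e.source) ∈ 𝓝 (q.eval (F s)) := by
      rw [hF s hs]
      exact Complex.isOpenMap_exp.image_mem_nhds hM
    filter_upwards [hsrc, q.continuous.continuousAt hM'] with z hz1 hz2
    obtain ⟨s', ⟨h1, h2⟩, h3⟩ := hz2
    refine ⟨s', h1, e.injOn h2 hz1 ?_⟩
    exact (hF s' h1).trans h3
  obtain ⟨ρ, hρ, hρV⟩ : ∃ ρ : ℝ, 0 < ρ ∧ ∀ z : ℂ, ρ < ‖z‖ → z ∈ V := by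
    have h1 := (q.tendsto_norm_atTop hq tendsto_norm_cocompact_atTop).eventually_gt_atTop R
    rw [Metric.cobounded_eq_cocompact.symm, ← comap_norm_atTop, eventually_comap] at h1
    obtain ⟨ρ, h2⟩ := eventually_atTop.1 h1
    refine ⟨max ρ 1, by positivity, fun z hz => h2 ‖z‖ ((le_max_left _ _).trans hz.le) z rfl⟩
  have hsub : ∀ F : ℂ → ℂ, (∀ s ∈ A, q.eval (F s) = Complex.exp s) → F '' A ⊆ V := by
    rintro F hF _ ⟨s, hs, rfl⟩
    change R < ‖q.eval (F s)‖
    rw [hF s hs]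
    exact (hexp s).1 hs
  obtain ⟨z₁, hz₁⟩ : V.Nonempty := ⟨((2 * ρ : ℝ) : ℂ), hρV _ (by
    rw [Complex.norm_real, Real.norm_of_nonneg (by positivity)]; linarith)⟩
  obtain ⟨F, hFc, hF, s₁, hs₁, hF₁⟩ := key z₁ hz₁
  refine ⟨F, hFc, hF, ?_⟩
  by_contra! hne
  obtain ⟨z₂, hz₂, hne⟩ := hne
  have hdisj : IsOpen (V \ F '' A) := by
    rw [isOpen_iff_mem_nhds]
    rintro z ⟨hz, hzF⟩
    obtain ⟨G, hGc, hG, s, hs, rfl⟩ := key z hz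
    filter_upwards [(hopen G hGc hG).mem_nhds ⟨s, hs, rfl⟩]
    rintro _ ⟨a, ha, rfl⟩
    refine ⟨hsub G hG ⟨a, ha, rfl⟩, ?_⟩
    rintro ⟨b, hb, hab⟩
    obtain ⟨n, hn⟩ := Complex.exp_eq_exp_iff_exists_int.1
      (((hF b hb).symm.trans (by rw [hab])).trans (hG a ha))
    have hre : ∀ x : ℂ, x ∈ A → x + n * (2 * Real.pi * Complex.I) ∈ A := by
      intro x hx
      simpa [hA] using hx
    have heq := eqOn_of_eval_eqOn q (s := A) (f := G)
      (g := fun x => F (x + n * (2 * Real.pi * Complex.I))) hAc.isPreconnected hGc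
      (hFc.comp (by fun_prop) hre)
      (fun x hx => by
        rw [hG x hx, hF _ (hre x hx), Complex.exp_eq_exp_iff_exists_int]
        exact ⟨-n, by push_cast; ring⟩)
      (fun x hx h0 => by
        have := hcrit _ h0
        rw [hG x hx] at this
        exact this.not_gt ((hexp x).1 hx)) ha (by rw [← hn, hab])
    exact hzF ⟨_, hre s hs, (heq hs).symm⟩
  have hfr : ∀ U : Set ℂ, IsOpen U → IsOpen (V \ U) → U ⊆ V →
      ∀ w ∈ frontier U, ¬ R < ‖q.eval w‖ := by
    intro U hU hU' hUV w hw hwV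
    rw [hU.frontier_eq] at hw
    obtain ⟨x, hx1, hx2⟩ := mem_closure_iff.1 hw.1 _ hU' ⟨hwV, hw.2⟩
    exact hx1.2 hx2
  have hbdd : ∀ U : Set ℂ, (∀ z, ρ < ‖z‖ → z ∉ U) → Bornology.IsBounded U := fun U h =>
    (Metric.isBounded_closedBall (x := (0 : ℂ)) (r := ρ)).subset fun z hz => by
      rw [mem_closedBall_zero_iff]
      by_contra! h'
      exact h z h' hz
  have hO := hopen F hFc hF
  rcases (isPreconnected_norm_gt ρ hρ).subset_or_subset hO hdisj disjoint_sdiff_right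
    (fun z hz => by by_cases h : z ∈ F '' A; exacts [.inl h, .inr ⟨hρV z hz, h⟩]) with h | h
  · obtain ⟨w, hw, hw'⟩ := exists_frontier_lt_norm_eval q (U := V \ F '' A)
      (hbdd _ fun z hz h' => h'.2 (h hz)) ⟨hz₂, fun ⟨s, hs, h⟩ => hne s hs h⟩ hz₂
    exact hfr _ hdisj (by rw [sdiff_sdiff_cancel_left (hsub F hF)]; exact hO) sdiff_subset w hw hw'
  · obtain ⟨w, hw, hw'⟩ := exists_frontier_lt_norm_eval q (U := F '' A)
      (hbdd _ fun z hz h' => (h hz).2 h') ⟨s₁, hs₁, hF₁⟩ hz₁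
    exact hfr _ hO hdisj (hsub F hF) w hw hw'

/-- The set of points with bounded forward orbit. -/
def filledJulia (P : ℂ → ℂ) : Set ℂ := {z | Bornology.IsBounded (range fun n => P^[n] z)}

section Escape

variable {P : ℂ → ℂ} {R : ℝ}

theorem le_norm_iterate (hgrow : ∀ z, R ≤ ‖z‖ → 2 * ‖z‖ ≤ ‖P z‖) {z : ℂ}
    (hz : R ≤ ‖z‖) (n : ℕ) : 2 ^ n * ‖z‖ ≤ ‖P^[n] z‖ := by
  induction n with
  | zero => simp
  | succ n ih =>
    have h1 : R ≤ ‖P^[n] z‖ :=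
      hz.trans ((le_mul_of_one_le_left (norm_nonneg z) (one_le_pow₀ one_le_two)).trans ih)
    rw [Function.iterate_succ_apply', pow_succ']
    linarith [hgrow _ h1]

theorem norm_le_norm_iterate (hgrow : ∀ z, R ≤ ‖z‖ → 2 * ‖z‖ ≤ ‖P z‖) {z : ℂ}
    (hz : R ≤ ‖z‖) (n : ℕ) : ‖z‖ ≤ ‖P^[n] z‖ :=
  (le_mul_of_one_le_left (norm_nonneg z) (one_le_pow₀ one_le_two)).trans
    (le_norm_iterate hgrow hz n)

theorem mem_filledJulia_iff_lt (hR : 0 < R) (hgrow : ∀ z, R ≤ ‖z‖ → 2 * ‖z‖ ≤ ‖P z‖) {z : ℂ} :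
    z ∈ filledJulia P ↔ ∀ n, ‖P^[n] z‖ < R := by
  constructor
  · intro hz
    by_contra! h
    obtain ⟨n, hn⟩ := h
    obtain ⟨C, hC⟩ := Bornology.IsBounded.exists_norm_le
      (show Bornology.IsBounded (range fun n => P^[n] z) from hz)
    obtain ⟨k, hk⟩ := pow_unbounded_of_one_lt (C / R) (one_lt_two (α := ℝ))
    have h1 := le_norm_iterate hgrow hn k
    rw [← Function.iterate_add_apply] at h1
    have h2 := hC _ (mem_range_self (k + n))
    rw [div_lt_iff₀ hR] at hk
    have : 2 ^ k * R ≤ 2 ^ k * ‖P^[n] z‖ := by gcongr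
    linarith
  · intro h
    change Bornology.IsBounded (range fun n => P^[n] z)
    refine isBounded_iff_forall_norm_le.2 ⟨R, ?_⟩
    rintro _ ⟨n, rfl⟩
    exact (h n).le

theorem mem_filledJulia_iff_le (hR : 0 < R) (hgrow : ∀ z, R ≤ ‖z‖ → 2 * ‖z‖ ≤ ‖P z‖) {z : ℂ} :
    z ∈ filledJulia P ↔ ∀ n, ‖P^[n] z‖ ≤ R := by
  rw [mem_filledJulia_iff_lt hR hgrow]
  refine ⟨fun h n => (h n).le, fun h n => (h n).lt_of_ne fun h0 => ?_⟩
  have h1 := hgrow _ h0.ge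
  rw [← Function.iterate_succ_apply' P] at h1
  linarith [h (n + 1)]

theorem isClosed_filledJulia (hP : Continuous P) (hR : 0 < R)
    (hgrow : ∀ z, R ≤ ‖z‖ → 2 * ‖z‖ ≤ ‖P z‖) : IsClosed (filledJulia P) := by
  have : filledJulia P = ⋂ n, {z | ‖P^[n] z‖ ≤ R} := by
    ext z; simp [mem_filledJulia_iff_le hR hgrow]
  rw [this]
  exact isClosed_iInter fun n => isClosed_le (hP.iterate n).norm continuous_const

theorem filledJulia_subset_closedBall (hR : 0 < R)
    (hgrow : ∀ z, R ≤ ‖z‖ → 2 * ‖z‖ ≤ ‖P z‖) : filledJulia P ⊆ Metric.closedBall 0 R := fun z hz => by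
  simpa using (mem_filledJulia_iff_le hR hgrow).1 hz 0

theorem mapsTo_filledJulia (hR : 0 < R) (hgrow : ∀ z, R ≤ ‖z‖ → 2 * ‖z‖ ≤ ‖P z‖) :
    MapsTo P (filledJulia P) (filledJulia P) := fun z hz => by
  rw [mem_filledJulia_iff_lt hR hgrow] at hz ⊢
  exact fun n => hz (n + 1)

end Escape

theorem eval_iterate_comp_X (p : ℂ[X]) (m : ℕ) (z : ℂ) :
    (p.comp^[m] X).eval z = (fun x => p.eval x)^[m] z := by
  rw [iterate_comp_eval, eval_X]

theorem exists_critical_of_iterate (p : ℂ[X]) (m : ℕ) {z : ℂ}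
    (h : (derivative (p.comp^[m] X)).eval z = 0) :
    ∃ j < m, p.derivative.eval ((fun x => p.eval x)^[j] z) = 0 := by
  induction m with
  | zero => simp at h
  | succ m ih =>
    rw [Function.iterate_succ_apply', derivative_comp, eval_mul, eval_comp,
      eval_iterate_comp_X, mul_eq_zero] at h
    rcases h with h | h
    · obtain ⟨j, hj, h⟩ := ih h
      exact ⟨j, by omega, h⟩
    · exact ⟨m, by omega, h⟩

theorem degree_pos_of_growth {p : ℂ[X]} {R : ℝ} (hR : 0 < R)
    (hgrow : ∀ z, R ≤ ‖z‖ → ‖z‖ ≤ ‖p.eval z‖) : 0 < p.degree := by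
  by_contra! h
  rw [eq_C_of_degree_le_zero h] at hgrow
  simp only [eval_C] at hgrow
  have h1 := hgrow ((max R (‖p.coeff 0‖ + 1) : ℝ) : ℂ)
  rw [Complex.norm_real, Real.norm_of_nonneg (by positivity)] at h1
  have := h1 (le_max_left _ _)
  linarith [le_max_right R (‖p.coeff 0‖ + 1)]

/-- The parametrization of the exterior of a level set of an iterate. -/
theorem exists_iterate_parametrization {p : ℂ[X]} {R : ℝ} (hR : 0 < R)
    (hgrow : ∀ z, R ≤ ‖z‖ → 2 * ‖z‖ ≤ ‖p.eval z‖) (m : ℕ)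
    (hcrit : ∀ c, p.derivative.eval c = 0 → ∀ j ≤ m, ‖(fun x => p.eval x)^[j] c‖ ≤ R) :
    (∀ c, (derivative (p.comp^[m] X)).eval c = 0 → ‖(p.comp^[m] X).eval c‖ ≤ R) ∧
    ∃ F : ℂ → ℂ, ContinuousOn F {s | Real.log R < s.re} ∧
      (∀ s, Real.log R < s.re → (p.comp^[m] X).eval (F s) = Complex.exp s) ∧
      ∀ z, R < ‖(p.comp^[m] X).eval z‖ → ∃ s, Real.log R < s.re ∧ F s = z := by
  have h : ∀ c, (derivative (p.comp^[m] X)).eval c = 0 → ‖(p.comp^[m] X).eval c‖ ≤ R := by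
    intro c hc
    obtain ⟨j, hj, h⟩ := exists_critical_of_iterate p m hc
    have := hcrit _ h (m - j) (by omega)
    rwa [← Function.iterate_add_apply, Nat.sub_add_cancel hj.le, ← eval_iterate_comp_X] at this
  refine ⟨h, exists_exterior_parametrization _ hR (degree_pos_of_growth hR fun z hz => ?_) h⟩
  rw [eval_iterate_comp_X]
  exact norm_le_norm_iterate hgrow hz m

/-- A decreasing sequence of compact connected sets has preconnected intersection. -/
theorem isPreconnected_iInter_of_antitone {X : Type*} [TopologicalSpace X] [T2Space X] {K : ℕ → Set X}
    (hK : Antitone K) (hc : ∀ n, IsCompact (K n)) (hp : ∀ n, IsPreconnected (K n)) :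
    IsPreconnected (⋂ n, K n) := by
  have hclosed : IsClosed (⋂ n, K n) := isClosed_iInter fun n => (hc n).isClosed
  rw [isPreconnected_iff_subset_of_fully_disjoint_closed hclosed]
  intro u v hu hv huv hd
  have hcpt : IsCompact (⋂ n, K n) := (hc 0).of_isClosed_subset hclosed (iInter_subset _ 0)
  obtain ⟨U, V, hU, hV, hU', hV', hUV⟩ := SeparatedNhds.of_isCompact_isCompact
    (hcpt.inter_right hu) (hcpt.inter_right hv)
    (hd.mono inter_subset_right inter_subset_right)
  obtain ⟨n, hn⟩ := exists_subset_nhds_of_isCompact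
    (directed_of_isDirected_le fun _ _ h => hK h) hc (U := U ∪ V) (fun x hx =>
      (hU.union hV).mem_nhds (by
        rcases huv hx with h | h
        exacts [.inl (hU' ⟨hx, h⟩), .inr (hV' ⟨hx, h⟩)]))
  rcases (hp n).subset_or_subset hU hV hUV hn with h | h
  · left
    intro x hx
    rcases huv hx with h' | h'
    · exact h'
    · exact (disjoint_left.1 hUV (h (mem_iInter.1 hx n)) (hV' ⟨hx, h'⟩)).elim
  · right
    intro x hx
    rcases huv hx with h' | h'
    · exact (disjoint_left.1 hUV (hU' ⟨hx, h'⟩) (h (mem_iInter.1 hx n))).elim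
    · exact h'

theorem exists_lt_norm_iterate {P : ℂ → ℂ} {z : ℂ} (hz : z ∉ filledJulia P) (C : ℝ) :
    ∃ n, C < ‖P^[n] z‖ := by
  by_contra! h
  refine hz (show Bornology.IsBounded (range fun n => P^[n] z) from
    isBounded_iff_forall_norm_le.2 ⟨C, ?_⟩)
  rintro _ ⟨n, rfl⟩
  exact h n

/-- The Julia set is the limit of the preimages of an annulus around infinity. -/
theorem frontier_filledJulia_eq_iInter {P : ℂ → ℂ} {R R₂ : ℝ} (hP : Continuous P) (hR : 0 < R)
    (hgrow : ∀ z, R ≤ ‖z‖ → 2 * ‖z‖ ≤ ‖P z‖) (hRR : 2 * R ≤ R₂)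
    (hR₂ : ∀ z, ‖z‖ ≤ 2 * R → ‖P z‖ ≤ R₂) :
    frontier (filledJulia P) =
      ⋂ n, closure (⋃ m ∈ Ici n, {z | 2 * R ≤ ‖P^[m] z‖ ∧ ‖P^[m] z‖ ≤ R₂}) := by
  have hmono : ∀ {z j n}, j ≤ n → R ≤ ‖P^[j] z‖ → ‖P^[j] z‖ ≤ ‖P^[n] z‖ := by
    intro z j n hjn hj
    have := norm_le_norm_iterate hgrow hj (n - j)
    rwa [← Function.iterate_add_apply, Nat.sub_add_cancel hjn] at this
  rw [frontier_eq_closure_inter_closure, (isClosed_filledJulia hP hR hgrow).closure_eq]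
  ext x
  rw [mem_iInter]
  constructor
  · rintro ⟨hxK, hx⟩ n
    rw [mem_closure_iff]
    intro U hU hxU
    have hU' : IsOpen (U ∩ {z | ‖P^[n] z‖ < R}) :=
      hU.inter (isOpen_lt (hP.iterate n).norm continuous_const)
    obtain ⟨z, ⟨hzU, hzn⟩, hzK⟩ := mem_closure_iff.1 hx _ hU'
      ⟨hxU, (mem_filledJulia_iff_lt hR hgrow).1 hxK n⟩
    have hex := exists_lt_norm_iterate hzK (2 * R)
    classical
    have hm := Nat.find_spec hex
    have hmin := @Nat.find_min _ _ hex
    set m := Nat.find hex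
    have hnm : n < m := by
      by_contra! h
      have h1 := hmono h (by linarith : R ≤ ‖P^[m] z‖)
      have hzn : ‖P^[n] z‖ < R := hzn
      linarith
    obtain ⟨k, hk⟩ : ∃ k, m = k + 1 := ⟨m - 1, by omega⟩
    have h2 := hR₂ _ (not_lt.1 (hmin (m := k) (by omega)))
    rw [← Function.iterate_succ_apply' P, Nat.succ_eq_add_one, ← hk] at h2
    exact ⟨z, hzU, mem_iUnion₂.2 ⟨m, hnm.le, hm.le, h2⟩⟩
  · intro hx
    constructor
    · by_contra hxK
      obtain ⟨k, hk⟩ := exists_lt_norm_iterate hxK R₂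
      have hW : IsOpen {z | R₂ < ‖P^[k] z‖} := isOpen_lt continuous_const (hP.iterate k).norm
      obtain ⟨z, hzW, hz⟩ := mem_closure_iff.1 (hx k) _ hW hk
      obtain ⟨m, hm, -, hz⟩ := mem_iUnion₂.1 hz
      have hzW : R₂ < ‖P^[k] z‖ := hzW
      have := hmono (z := z) (mem_Ici.1 hm) (by linarith)
      linarith
    · refine closure_mono ?_ (hx 0)
      intro z hz hzK
      obtain ⟨m, -, h1, -⟩ := mem_iUnion₂.1 hz
      have := (mem_filledJulia_iff_lt hR hgrow).1 hzK m
      linarith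

/-- If all critical points have bounded orbit, then the Julia set is preconnected. -/
theorem isPreconnected_frontier_filledJulia {p : ℂ[X]} {R : ℝ} (hR : 0 < R)
    (hgrow : ∀ z, R ≤ ‖z‖ → 2 * ‖z‖ ≤ ‖p.eval z‖)
    (hcrit : ∀ c, p.derivative.eval c = 0 → ∀ j, ‖(fun x => p.eval x)^[j] c‖ ≤ R) :
    IsPreconnected (frontier (filledJulia fun x => p.eval x)) := by
  set P : ℂ → ℂ := fun x => p.eval x with hPdef
  have hP : Continuous P := p.continuous
  obtain ⟨R₂, hR₂⟩ := (isCompact_closedBall (0 : ℂ) (2 * R)).exists_bound_of_continuousOn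
    hP.continuousOn
  have hR₂' : ∀ z, ‖z‖ ≤ 2 * R → ‖P z‖ ≤ R₂ := fun z hz => hR₂ z (by simpa using hz)
  set w₀ : ℂ := ((2 * R : ℝ) : ℂ) with hw₀
  have hnw : ‖w₀‖ = 2 * R := by rw [hw₀, Complex.norm_real, Real.norm_of_nonneg (by positivity)]
  have hw₁ : 2 * ‖w₀‖ ≤ ‖P w₀‖ := hgrow _ (by linarith)
  have hw₂ : ‖P w₀‖ ≤ R₂ := hR₂' _ hnw.le
  have hRR : 2 * R ≤ R₂ := by linarith
  set E : ℕ → Set ℂ := fun m => {z | 2 * R ≤ ‖P^[m] z‖ ∧ ‖P^[m] z‖ ≤ R₂} with hE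
  have hEpre : ∀ m, IsPreconnected (E m) := by
    intro m
    obtain ⟨-, F, hFc, hF, hFs⟩ := exists_iterate_parametrization hR hgrow m
      fun c hc j _ => hcrit c hc j
    set B : Set ℂ := {s | Real.log (2 * R) ≤ s.re} ∩ {s | s.re ≤ Real.log R₂} with hB
    have hBA : B ⊆ {s | Real.log R < s.re} := fun s hs =>
      (Real.log_lt_log hR (by linarith)).trans_le hs.1
    have hBE : ∀ s, s ∈ B ↔ 2 * R ≤ ‖Complex.exp s‖ ∧ ‖Complex.exp s‖ ≤ R₂ := fun s => by
      rw [Complex.norm_exp, ← Real.log_le_iff_le_exp (by linarith),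
        ← Real.le_log_iff_exp_le (by linarith)]
      rfl
    have : E m = F '' B := by
      ext z
      constructor
      · intro hz
        have hz' : 2 * R ≤ ‖P^[m] z‖ ∧ ‖P^[m] z‖ ≤ R₂ := hz
        obtain ⟨s, hs, rfl⟩ := hFs z (by rw [eval_iterate_comp_X]; linarith [hz'.1])
        refine ⟨s, (hBE s).2 ?_, rfl⟩
        rwa [← hF s hs, eval_iterate_comp_X]
      · rintro ⟨s, hs, rfl⟩
        have := (hBE s).1 hs
        rwa [← hF s (hBA hs), eval_iterate_comp_X] at this
    rw [this]
    exact ((convex_halfSpace_re_ge _).inter (convex_halfSpace_re_le _)).isPreconnected.image _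
      (hFc.mono hBA)
  have hEinter : ∀ m, (E m ∩ E (m + 1)).Nonempty := by
    intro m
    have hdeg : 0 < (p.comp^[m] X).degree := degree_pos_of_growth hR fun z hz => by
      rw [eval_iterate_comp_X]
      exact norm_le_norm_iterate hgrow hz m
    obtain ⟨z, hz⟩ := IsAlgClosed.exists_root (p.comp^[m] X - C w₀)
      (by rw [degree_sub_C hdeg]; exact hdeg.ne')
    rw [IsRoot, eval_sub, eval_C, sub_eq_zero, eval_iterate_comp_X] at hz
    have hz : P^[m] z = w₀ := hz
    refine ⟨z, ?_, ?_⟩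
    · simp only [hE, mem_ofPred_eq, hz]
      exact ⟨hnw.ge, by linarith⟩
    · simp only [hE, mem_ofPred_eq, Function.iterate_succ_apply', hz]
      exact ⟨by linarith, hw₂⟩
  rw [frontier_filledJulia_eq_iInter hP hR hgrow hRR hR₂']
  refine isPreconnected_iInter_of_antitone ?_ ?_ ?_
  · intro a b hab
    exact closure_mono (biUnion_subset_biUnion_left (Ici_subset_Ici.2 hab))
  · intro n
    refine Metric.isCompact_of_isClosed_isBounded isClosed_closure (Bornology.IsBounded.closure ?_)
    refine (Metric.isBounded_closedBall (x := (0 : ℂ)) (r := R₂)).subset fun z hz => ?_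
    obtain ⟨m, -, h1, h2⟩ := mem_iUnion₂.1 hz
    rw [mem_closedBall_zero_iff]
    by_contra! h
    have := norm_le_norm_iterate hgrow (show R ≤ ‖z‖ by linarith) m
    linarith
  · intro n
    refine (IsPreconnected.biUnion_of_chain ordConnected_Ici (fun m _ => hEpre m) ?_).closure
    intro m _ _
    exact hEinter m

/-- `φ` lifts through `p` with arbitrary initial condition. -/
def HasLifts {A : Type*} [TopologicalSpace A] (p : ℂ → ℂ) (φ : A → ℂ) : Prop :=
  ∀ a e, p e = φ a → ∃ g : A → ℂ, Continuous g ∧ (∀ x, p (g x) = φ x) ∧ g a = e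

/-- The lifting property is invariant under homotopy. -/
theorem HasLifts.of_homotopy {A : Type*} [TopologicalSpace A] {p : ℂ → ℂ} {s : Set ℂ}
    (hp : IsCoveringMapOn p s) {H : I × A → ℂ} (hH : Continuous H) (hHs : ∀ x, H x ∈ s)
    (h0 : HasLifts p fun a => H (0, a)) : HasLifts p fun a => H (1, a) := by
  intro a e he
  have cov := hp.isCoveringMap_restrictPreimage
  set P := s.restrictPreimage p
  have hes : e ∈ p ⁻¹' s := by
    change p e ∈ s
    rw [he]; exact hHs _
  let γ : C(I, s) := ⟨fun t => ⟨H (σ t, a), hHs _⟩, by fun_prop⟩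
  have hγ : γ 0 = P ⟨e, hes⟩ := by
    apply Subtype.ext
    simp [γ, P, he]
  set Γ := cov.liftPath γ ⟨e, hes⟩ hγ with hΓ
  have hΓl : ∀ t, P (Γ t) = γ t := fun t => congrFun (cov.liftPath_lifts γ ⟨e, hes⟩ hγ) t
  have hΓ0 : Γ 0 = ⟨e, hes⟩ := cov.liftPath_zero γ ⟨e, hes⟩ hγ
  have h1 : p (Γ 1 : ℂ) = H (0, a) := by
    simpa [γ, P] using congrArg Subtype.val (hΓl 1)
  obtain ⟨g, hg, hgl, hga⟩ := h0 a (Γ 1 : ℂ) h1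
  let H' : C(I × A, s) := ⟨fun x => ⟨H x, hHs x⟩, by fun_prop⟩
  have hgs : ∀ x, g x ∈ p ⁻¹' s := fun x => by
    change p (g x) ∈ s
    rw [hgl]; exact hHs _
  let f : C(A, p ⁻¹' s) := ⟨fun x => ⟨g x, hgs x⟩, by fun_prop⟩
  have hf : ∀ x, H' (0, x) = P (f x) := fun x => Subtype.ext (hgl x).symm
  set G := cov.liftHomotopy H' f hf
  have hG : ∀ x, P (G x) = H' x := fun x => congrFun (cov.liftHomotopy_lifts H' f hf) x
  refine ⟨fun x => (G (1, x) : ℂ), by fun_prop,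
    fun x => congrArg Subtype.val (hG (1, x)), ?_⟩
  have := cov.eq_of_comp_eq (A := I) (g₁ := fun t => G (σ t, a)) (g₂ := Γ) (by fun_prop)
    (by fun_prop) (by
      ext t
      exact congrArg Subtype.val ((hG (σ t, a)).trans (hΓl t).symm)) 1 (by
      apply Subtype.ext
      have h2 : G (0, a) = f a := cov.liftHomotopy_zero H' f hf a
      simp only [unitInterval.symm_one, h2]
      exact hga)
  have h3 := congrFun this 0
  simp only [unitInterval.symm_zero, hΓ0] at h3
  exact congrArg Subtype.val h3

theorem hasLifts_const {A : Type*} [TopologicalSpace A] (p : ℂ → ℂ) (c : ℂ) :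
    HasLifts p fun _ : A => c := fun _ e he =>
  ⟨fun _ => e, continuous_const, fun _ => he, rfl⟩

/-- If two distinct points can be moved to infinity in the complement of a bounded set `S` without
colliding, then `S` lifts through any map covering the complement of these points. -/
theorem hasLifts_of_escaping_paths {p : ℂ → ℂ} {S : Set ℂ} {ρ : ℝ}
    (hS : ∀ w ∈ S, ‖w‖ < ρ) {u v : I → ℂ} (hu : Continuous u) (hv : Continuous v)
    (hne : ∀ t, u t ≠ v t) (huS : ∀ t, u t ∉ S) (hvS : ∀ t, v t ∉ S)
    (hu1 : ρ ≤ ‖u 1‖) (hv1 : ρ ≤ ‖v 1‖) (hp : IsCoveringMapOn p {u 0, v 0}ᶜ) :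
    HasLifts p fun w : S => (w : ℂ) := by
  have hd : ∀ t, v t - u t ≠ 0 := fun t => sub_ne_zero.2 (hne t).symm
  have hd0 := hd 0
  -- the affine map sending `u t`, `v t` to `u 0`, `v 0`
  have havoid : ∀ t w, w ≠ u t → w ≠ v t →
      u 0 + (w - u t) * ((v 0 - u 0) / (v t - u t)) ∈ ({u 0, v 0}ᶜ : Set ℂ) := by
    intro t w h1 h2
    have hdt := hd t
    simp only [mem_compl_iff, mem_insert_iff, mem_singleton_iff, not_or]
    constructor
    · intro h
      rw [add_eq_left, mul_eq_zero, div_eq_zero_iff] at h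
      rcases h with h | h | h
      · exact h1 (sub_eq_zero.1 h)
      · exact hd0 h
      · exact hdt h
    · intro h
      apply h2
      have : (w - u t) * ((v 0 - u 0) / (v t - u t)) = v 0 - u 0 := by linear_combination h
      field_simp at this
      linear_combination this
  have step1 : HasLifts p fun w : S =>
      u 0 + (((1 : I) : ℝ) * (w : ℂ) - u 1) * ((v 0 - u 0) / (v 1 - u 1)) := by
    refine HasLifts.of_homotopy hp
      (H := fun x : I × S => u 0 + ((x.1 : ℝ) * (x.2 : ℂ) - u 1) * ((v 0 - u 0) / (v 1 - u 1)))
      (by fun_prop) (fun x => ?_) ?_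
    · have : ‖((x.1 : ℝ) : ℂ) * (x.2 : ℂ)‖ < ρ := by
        rw [norm_mul, Complex.norm_real, Real.norm_of_nonneg x.1.2.1]
        exact (mul_le_of_le_one_left (norm_nonneg _) x.1.2.2).trans_lt (hS _ x.2.2)
      exact havoid 1 _ (fun h => by rw [h] at this; linarith)
        (fun h => by rw [h] at this; linarith)
    · simpa using hasLifts_const p _
  have step2 := HasLifts.of_homotopy hp
    (H := fun x : I × S =>
      u 0 + ((x.2 : ℂ) - u (σ x.1)) * ((v 0 - u 0) / (v (σ x.1) - u (σ x.1))))
    (by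
      refine continuous_const.add ((by fun_prop : Continuous fun x : I × S => (x.2 : ℂ) - u (σ x.1)).mul
        (continuous_const.div (by fun_prop) fun x => hd _)))
    (fun x => havoid _ _ (fun h => huS _ (h ▸ x.2.2)) (fun h => hvS _ (h ▸ x.2.2)))
    (by simpa using step1)
  convert step2 using 2 with w
  simp only [unitInterval.symm_one]
  field_simp
  ring

/-- Local inverse branches of a polynomial are global on `S` when `S` has the lifting property. -/
theorem exists_branch {p : ℂ[X]} {S : Set ℂ} (hS : IsOpen S)
    (hlift : HasLifts (fun x => p.eval x) fun w : S => (w : ℂ))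
    (hcrit : ∀ c, p.derivative.eval c = 0 → p.eval c ∉ S) {x₀ : ℂ} (hx₀ : p.eval x₀ ∈ S) :
    ∃ g : ℂ → ℂ, DifferentiableOn ℂ g S ∧ (∀ w ∈ S, p.eval (g w) = w) ∧ g (p.eval x₀) = x₀ := by
  obtain ⟨g, hg, hgl, hg0⟩ := hlift ⟨_, hx₀⟩ x₀ rfl
  classical
  have hval : ∀ w (hw : w ∈ S), (if h : w ∈ S then g ⟨w, h⟩ else 0) = g ⟨w, hw⟩ :=
    fun w hw => dif_pos hw
  set G : ℂ → ℂ := fun w => if h : w ∈ S then g ⟨w, h⟩ else 0 with hG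
  have hGc : ContinuousOn G S := by
    rw [continuousOn_iff_continuous_domRestrict]
    convert hg using 1
    ext s
    exact hval s s.2
  have hGl : ∀ w ∈ S, p.eval (G w) = w := fun w hw => by
    rw [hG]; simp only [hval w hw]; exact hgl ⟨w, hw⟩
  refine ⟨G, fun w hw => ?_, hGl, (hval _ hx₀).trans hg0⟩
  have hev : ∀ᶠ y in 𝓝 w, p.eval (G y) = y := by
    filter_upwards [hS.mem_nhds hw] with y hy using hGl y hy
  exact (HasDerivAt.of_local_left_inverse (hGc.continuousAt (hS.mem_nhds hw)) (p.hasDerivAt (G w))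
    (fun h => hcrit _ h (by rwa [hGl w hw])) hev).differentiableAt.differentiableWithinAt

/-- Expanding an exterior parametrization outwards gives the paths along which two points escape. -/
theorem hasLifts_of_exterior_parametrization {p q : ℂ[X]} {R ρ : ℝ} (hR : 0 < R) {S : Set ℂ}
    (hq : ∀ c, q.derivative.eval c = 0 → ‖q.eval c‖ ≤ R)
    (hSq : ∀ w ∈ S, ‖q.eval w‖ ≤ R) (hS : ∀ w ∈ S, ‖w‖ < ρ) {F : ℂ → ℂ}
    (hFc : ContinuousOn F {s | Real.log R < s.re})
    (hF : ∀ s, Real.log R < s.re → q.eval (F s) = Complex.exp s)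
    (hFs : ∀ z, R < ‖q.eval z‖ → ∃ s, Real.log R < s.re ∧ F s = z)
    {c₁ c₂ : ℂ} (hc : ∀ c, p.derivative.eval c = 0 → c = c₁ ∨ c = c₂)
    (hne : p.eval c₁ ≠ p.eval c₂) (h₁ : R < ‖q.eval (p.eval c₁)‖)
    (h₂ : R < ‖q.eval (p.eval c₂)‖) :
    HasLifts (fun x => p.eval x) fun w : S => (w : ℂ) := by
  obtain ⟨s₁, hs₁, hF₁⟩ := hFs _ h₁
  obtain ⟨s₂, hs₂, hF₂⟩ := hFs _ h₂
  have hlt : ∀ {s : ℂ} {τ : ℝ}, Real.log R < s.re → 0 ≤ τ → Real.log R < (s + τ).re := by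
    intro s τ hs hτ
    simp only [Complex.add_re, Complex.ofReal_re]
    linarith
  have hout : ∀ {s : ℂ}, Real.log R < s.re → R < ‖q.eval (F s)‖ := by
    intro s hs
    rw [hF s hs, Complex.norm_exp]
    exact (Real.log_lt_iff_lt_exp hR).1 hs
  have hray : ∀ {s : ℂ}, Real.log R < s.re → ContinuousOn (fun τ : ℝ => F (s + τ)) (Ici 0) :=
    fun hs => hFc.comp (by fun_prop) fun τ hτ => hlt hs hτ
  have hcoll : ∀ τ : ℝ, 0 ≤ τ → F (s₁ + τ) ≠ F (s₂ + τ) := by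
    intro τ hτ h
    have hexp : Complex.exp s₁ = Complex.exp s₂ := by
      have h' := congrArg q.eval h
      rw [hF _ (hlt hs₁ hτ), hF _ (hlt hs₂ hτ), Complex.exp_add, Complex.exp_add] at h'
      exact mul_right_cancel₀ (Complex.exp_ne_zero _) h'
    have heq := eqOn_of_eval_eqOn q (s := Ici (0 : ℝ)) isPreconnected_Ici (hray hs₁) (hray hs₂)
      (fun x hx => by
        rw [hF _ (hlt hs₁ hx), hF _ (hlt hs₂ hx), Complex.exp_add, Complex.exp_add, hexp])
      (fun x hx h0 => (hq _ h0).not_gt (hout (hlt hs₁ hx))) hτ h (mem_Ici.2 le_rfl)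
    simp only [Complex.ofReal_zero, add_zero, hF₁, hF₂] at heq
    exact hne heq
  obtain ⟨B, hB⟩ := (isCompact_closedBall (0 : ℂ) ρ).exists_bound_of_continuousOn
    q.continuous.continuousOn
  set T : ℝ := max 0 (max (Real.log (max B 0 + 1) - s₁.re) (Real.log (max B 0 + 1) - s₂.re)) + 1
  have hT0 : 0 ≤ T := by positivity
  have hfar : ∀ {s : ℂ}, Real.log R < s.re → Real.log (max B 0 + 1) < s.re + T →
      ρ ≤ ‖F (s + T)‖ := by
    intro s hs hsT
    by_contra! h
    have h1 := hB _ (mem_closedBall_zero_iff.2 h.le)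
    rw [hF _ (hlt hs hT0), Complex.norm_exp, Complex.add_re, Complex.ofReal_re] at h1
    have h2 := (Real.log_lt_iff_lt_exp (by positivity)).1 hsT
    linarith [le_max_left B 0]
  have hpath : ∀ {s : ℂ}, Real.log R < s.re → Continuous fun t : I => F (s + (t * T : ℝ)) := by
    intro s hs
    exact (hray hs).comp_continuous (f := fun t : I => (t : ℝ) * T) (by fun_prop)
      fun t => mul_nonneg t.2.1 hT0
  have hnotS : ∀ {s : ℂ}, Real.log R < s.re → ∀ t : I, F (s + (t * T : ℝ)) ∉ S := fun hs t h =>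
    (hSq _ h).not_gt (hout (hlt hs (mul_nonneg t.2.1 hT0)))
  refine hasLifts_of_escaping_paths hS (hpath hs₁) (hpath hs₂)
    (fun t => hcoll _ (mul_nonneg t.2.1 hT0)) (hnotS hs₁) (hnotS hs₂) ?_ ?_ ?_
  · have : Real.log (max B 0 + 1) - s₁.re < T :=
      (((le_max_left _ _).trans (le_max_right _ _)).trans_lt (lt_add_one _))
    simpa using hfar hs₁ (by linarith)
  · have : Real.log (max B 0 + 1) - s₂.re < T :=
      (((le_max_right _ _).trans (le_max_right _ _)).trans_lt (lt_add_one _))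
    simpa using hfar hs₂ (by linarith)
  · refine p.isCoveringMapOn_eval.mono ?_
    simp only [Icc.coe_zero, zero_mul, Complex.ofReal_zero, add_zero, hF₁, hF₂]
    rw [compl_subset_compl]
    rintro _ ⟨c, h0, rfl⟩
    rcases hc c h0 with rfl | rfl <;> simp

/-- `G` contracts by the factor `κ` the Carathéodory metric of `S` (compared to the distance to the
complement of `S`). -/
def HasDerivBound (S : Set ℂ) (G : ℂ → ℂ) (κ : ℝ) : Prop :=
  ∀ h : ℂ → ℂ, DifferentiableOn ℂ h S → (∀ w ∈ S, ‖h w‖ ≤ 1) → ∀ δ > 0, ∀ z,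
    Metric.closedBall z δ ⊆ S → ‖deriv (h ∘ G) z‖ ≤ κ / δ

theorem hasDerivBound_id (S : Set ℂ) : HasDerivBound S id 1 := by
  intro h hh h1 δ hδ z hz
  rw [Function.comp_id]
  exact Complex.norm_deriv_le_of_forall_mem_sphere_norm_le hδ (hh.diffContOnCl_ball hz)
    fun w hw => h1 w (hz (Metric.sphere_subset_closedBall hw))

/-- The Earle–Hamilton contraction argument. -/
theorem HasDerivBound.comp {S : Set ℂ} (hS : IsOpen S) {G g : ℂ → ℂ} {κ t D ε : ℝ}
    (hG : HasDerivBound S G κ) (hGd : DifferentiableOn ℂ G S) (hGS : MapsTo G S S)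
    (hgd : DifferentiableOn ℂ g S) (hgε : ∀ w ∈ S, Metric.ball (g w) ε ⊆ S)
    (hgS : MapsTo g S S) (hD : ∀ x ∈ S, ∀ y ∈ S, ‖x - y‖ ≤ D) (ht : 0 < t) (htD : t * D < ε) :
    HasDerivBound S (g ∘ G) (κ / (1 + t)) := by
  intro h hh h1 δ hδ z hz
  have hzS : z ∈ S := hz (Metric.mem_closedBall_self hδ.le)
  set y := G z with hy
  have hyS : y ∈ S := hGS hzS
  set k : ℂ → ℂ := fun w => g w + t * (g w - g y) with hk
  have hkS : MapsTo k S S := fun w hw => hgε w hw (by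
    rw [Metric.mem_ball, dist_eq_norm, hk]
    simp only [add_sub_cancel_left, norm_mul, Complex.norm_real, Real.norm_of_nonneg ht.le]
    refine (mul_le_mul_of_nonneg_left (hD _ (hgS hw) _ (hgS hyS)) ht.le).trans_lt htD)
  have hkd : DifferentiableOn ℂ k S :=
    hgd.add ((hgd.sub (differentiableOn_const _)).const_mul _)
  have hky : k y = g y := by simp [hk]
  have hbound := hG (h ∘ k) (hh.comp hkd hkS) (fun w hw => h1 _ (hkS hw)) δ hδ z hz
  have dG : HasDerivAt G (deriv G z) z := (hGd.differentiableAt (hS.mem_nhds hzS)).hasDerivAt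
  have dg : HasDerivAt g (deriv g y) y := (hgd.differentiableAt (hS.mem_nhds hyS)).hasDerivAt
  have dh : HasDerivAt h (deriv h (g y)) (g y) :=
    (hh.differentiableAt (hS.mem_nhds (hgS hyS))).hasDerivAt
  have dk : HasDerivAt k (deriv g y + t * deriv g y) y :=
    dg.add ((dg.sub_const _).const_mul _)
  have e1 : deriv (h ∘ g ∘ G) z = deriv h (g y) * (deriv g y * deriv G z) :=
    (HasDerivAt.comp z (h₂ := h) (h := g ∘ G) dh (dg.comp z dG)).deriv
  have e2 : deriv ((h ∘ k) ∘ G) z =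
      deriv h (g y) * (deriv g y + t * deriv g y) * deriv G z :=
    (HasDerivAt.comp z (h₂ := h ∘ k) (h := G) (HasDerivAt.comp y (hky ▸ dh) dk) dG).deriv
  have e3 : deriv ((h ∘ k) ∘ G) z = ((1 + t : ℝ) : ℂ) * deriv (h ∘ g ∘ G) z := by
    rw [e1, e2]; push_cast; ring
  rw [e3, norm_mul, Complex.norm_real, Real.norm_of_nonneg (by positivity)] at hbound
  rw [div_right_comm, le_div_iff₀ (by positivity)]
  linarith

/-- A connected set covered by finitely many sets of radius at most `η` has diameter at most twice
the sum of the radii. -/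
theorem dist_le_of_isPreconnected_of_cover {X ι : Type*} [PseudoMetricSpace X] {C : Set X}
    (hC : IsPreconnected C) (t : Finset ι) (c : ι → X) {η : ℝ} (hη : 0 ≤ η)
    (hcov : ∀ x ∈ C, ∃ i ∈ t, dist x (c i) ≤ η) {a b : X} (ha : a ∈ C) (hb : b ∈ C) :
    dist a b ≤ t.card * (2 * η) := by
  have himg : IsPreconnected ((fun x => dist x a) '' C) := hC.image _ (by fun_prop)
  have hIcc : Icc 0 (dist a b) ⊆ (fun x => dist x a) '' C :=
    himg.ordConnected.out ⟨a, ha, dist_self a⟩ ⟨b, hb, dist_comm b a⟩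
  have hsub : Icc 0 (dist a b) ⊆ ⋃ i ∈ t, Metric.closedBall (dist (c i) a) η := by
    intro r hr
    obtain ⟨x, hx, rfl⟩ := hIcc hr
    obtain ⟨i, hi, hxi⟩ := hcov x hx
    exact mem_iUnion₂.2 ⟨i, hi, by
      rw [Metric.mem_closedBall]
      exact (dist_dist_dist_le_left x (c i) a).trans hxi⟩
  have h1 := (MeasureTheory.measure_mono (μ := MeasureTheory.volume) hsub).trans
    (MeasureTheory.measure_biUnion_finset_le t _)
  simp only [Real.volume_Icc, Real.volume_closedBall, Finset.sum_const, sub_zero,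
    nsmul_eq_mul] at h1
  rw [← ENNReal.ofReal_natCast, ← ENNReal.ofReal_mul (by positivity),
    ENNReal.ofReal_le_ofReal_iff (by positivity)] at h1
  exact h1

/-- If all inverse branches of `p` exist on an open bounded neighbourhood `S` of a forward invariant
set `K`, and map `S` into a compact subset of `S`, then `K` is totally disconnected. -/
theorem isTotallyDisconnected_of_branches {p : ℂ[X]} {S T K : Set ℂ} (hS : IsOpen S)
    (hSb : Bornology.IsBounded S) (hT : IsCompact T) (hTS : T ⊆ S)
    (hpT : ∀ z, p.eval z ∈ S → z ∈ T) (hKT : K ⊆ T) (hpK : MapsTo (fun x => p.eval x) K K)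
    (hcrit : ∀ c, p.derivative.eval c = 0 → p.eval c ∉ S)
    (hbranch : ∀ x₀, p.eval x₀ ∈ S → ∃ g : ℂ → ℂ, DifferentiableOn ℂ g S ∧
      (∀ w ∈ S, p.eval (g w) = w) ∧ g (p.eval x₀) = x₀) :
    IsTotallyDisconnected K := by
  obtain ⟨ε, hε, hεS⟩ := hT.exists_thickening_subset_open hS hTS
  have hball : ∀ z ∈ T, Metric.ball z ε ⊆ S := fun z hz =>
    (Metric.ball_subset_thickening hz ε).trans hεS
  obtain ⟨ρ, hρ⟩ := hSb.exists_norm_le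
  set M : ℝ := max ρ 1
  have hM : 0 < M := by positivity
  have hMS : ∀ w ∈ S, ‖w‖ ≤ M := fun w hw => (hρ w hw).trans (le_max_left _ _)
  have hD : ∀ x ∈ S, ∀ y ∈ S, ‖x - y‖ ≤ 2 * M := fun x hx y hy =>
    (norm_sub_le x y).trans (by linarith [hMS x hx, hMS y hy])
  set t : ℝ := ε / (4 * M) with ht
  have ht0 : 0 < t := by positivity
  have htD : t * (2 * M) < ε := by
    rw [ht]; field_simp; linarith
  have hword : ∀ n : ℕ, ∀ C ⊆ K, IsPreconnected C → C.Nonempty → ∃ G : ℂ → ℂ,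
      DifferentiableOn ℂ G S ∧ MapsTo G S S ∧ HasDerivBound S G (1 / (1 + t) ^ n) ∧
      ∀ x ∈ C, G ((fun x => p.eval x)^[n] x) = x := by
    intro n
    induction n with
    | zero =>
      intro C _ _ _
      exact ⟨id, differentiableOn_id, mapsTo_id S, by simpa using hasDerivBound_id S,
        fun x _ => rfl⟩
    | succ n ih =>
      rintro C hCK hC ⟨x₀, hx₀⟩
      have hCp : MapsTo (fun x => p.eval x) C S := fun x hx => hTS (hKT (hpK (hCK hx)))
      obtain ⟨G, hGd, hGS, hGb, hG⟩ := ih ((fun x => p.eval x) '' C)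
        (image_subset_iff.2 fun x hx => hpK (hCK hx)) (hC.image _ p.continuous.continuousOn)
        ⟨_, x₀, hx₀, rfl⟩
      obtain ⟨g, hgd, hg, hg0⟩ := hbranch x₀ (hCp hx₀)
      have hgT : ∀ w ∈ S, g w ∈ T := fun w hw => hpT _ (by rwa [hg w hw])
      have hgS : MapsTo g S S := fun w hw => hTS (hgT w hw)
      have heq : EqOn id (fun x => g (p.eval x)) C := eqOn_of_eval_eqOn p hC continuousOn_id
        (hgd.continuousOn.comp p.continuous.continuousOn hCp)
        (fun x hx => (hg _ (hCp hx)).symm) (fun x hx h0 => hcrit _ h0 (hCp hx)) hx₀ hg0.symm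
      refine ⟨g ∘ G, hgd.comp hGd hGS, hgS.comp hGS, ?_, fun x hx => ?_⟩
      · have := hGb.comp hS hGd hGS hgd (fun w hw => hball _ (hgT w hw)) hgS hD ht0 htD
        rwa [div_div, ← pow_succ] at this
      · rw [Function.comp_apply, Function.iterate_succ_apply, hG _ ⟨x, hx, rfl⟩]
        exact (heq hx).symm
  set δ : ℝ := ε / 3 with hδ
  have hδ0 : 0 < δ := by positivity
  obtain ⟨F, hFT, hFcov⟩ := hT.elim_nhds_subcover (fun z => Metric.ball z δ)
    fun z _ => Metric.ball_mem_nhds z hδ0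
  have hclosed : ∀ z ∈ T, ∀ w ∈ Metric.ball z δ, Metric.closedBall w δ ⊆ S := by
    intro z hz w hw x hx
    apply hball z hz
    rw [Metric.mem_ball] at hw ⊢
    rw [Metric.mem_closedBall] at hx
    have := dist_triangle x w z
    linarith
  have hosc : ∀ G : ℂ → ℂ, ∀ κ : ℝ, DifferentiableOn ℂ G S → MapsTo G S S →
      HasDerivBound S G κ → 0 ≤ κ → ∀ z ∈ T, ∀ w ∈ Metric.ball z δ, dist (G w) (G z) ≤ M * κ := by
    intro G κ hGd hGS hGb hκ z hz w hw
    have hd : ∀ x ∈ Metric.ball z δ, DifferentiableAt ℂ G x := fun x hx =>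
      hGd.differentiableAt (hS.mem_nhds (hclosed z hz x hx (Metric.mem_closedBall_self hδ0.le)))
    have hb : ∀ x ∈ Metric.ball z δ, ‖deriv G x‖ ≤ M * κ / δ := by
      intro x hx
      have h1 := hGb (fun w => (M : ℂ)⁻¹ * w) (by fun_prop) (fun w hw => by
        rw [norm_mul, norm_inv, Complex.norm_real, Real.norm_of_nonneg hM.le, inv_mul_le_iff₀ hM]
        simpa using hMS w hw) δ hδ0 x (hclosed z hz x hx)
      have h2 : deriv ((fun w => (M : ℂ)⁻¹ * w) ∘ G) x = (M : ℂ)⁻¹ * deriv G x :=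
        ((hd x hx).hasDerivAt.const_mul _).deriv
      rw [h2, norm_mul, norm_inv, Complex.norm_real, Real.norm_of_nonneg hM.le,
        inv_mul_le_iff₀ hM, ← mul_div_assoc] at h1
      exact h1
    have h3 := (convex_ball z δ).norm_image_sub_le_of_norm_deriv_le hd hb
      (Metric.mem_ball_self hδ0) hw
    rw [dist_eq_norm]
    refine h3.trans ?_
    rw [← dist_eq_norm]
    calc M * κ / δ * dist w z ≤ M * κ / δ * δ := by
          have := (Metric.mem_ball.1 hw).le
          gcongr
      _ = M * κ := by field_simp
  intro C hCK hC a ha b hb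
  have hle : ∀ n : ℕ, dist a b ≤ F.card * (2 * (M * (1 / (1 + t) ^ n))) := by
    intro n
    obtain ⟨G, hGd, hGS, hGb, hG⟩ := hword n C hCK hC ⟨a, ha⟩
    refine dist_le_of_isPreconnected_of_cover hC F G (by positivity) (fun x hx => ?_) ha hb
    have hxT := hKT (hpK.iterate n (hCK hx))
    obtain ⟨z, hz, hxz⟩ := mem_iUnion₂.1 (hFcov hxT)
    refine ⟨z, hz, ?_⟩
    have := hosc G _ hGd hGS hGb (by positivity) z (hFT z hz) _ hxz
    rwa [hG x hx] at this
  have hlim : Tendsto (fun n : ℕ => (F.card : ℝ) * (2 * (M * (1 / (1 + t) ^ n)))) atTop (𝓝 0) := by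
    have h1 : Tendsto (fun n : ℕ => 1 / (1 + t) ^ n) atTop (𝓝 0) := by
      simp only [one_div]
      exact tendsto_inv_atTop_zero.comp
        (tendsto_pow_atTop_atTop_of_one_lt (by linarith : 1 < 1 + t))
    simpa using ((h1.const_mul M).const_mul 2).const_mul (F.card : ℝ)
  exact dist_le_zero.1 (ge_of_tendsto' hlim hle)

/-- If `p` has two critical points, with distinct critical values, which escape at the same time,
then the filled-in Julia set is totally disconnected. -/
theorem isTotallyDisconnected_filledJulia {p : ℂ[X]} {R : ℝ} (hR : 0 < R)
    (hgrow : ∀ z, R ≤ ‖z‖ → 2 * ‖z‖ ≤ ‖p.eval z‖) {c₁ c₂ : ℂ}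
    (hc : ∀ c, p.derivative.eval c = 0 → c = c₁ ∨ c = c₂) (hne : p.eval c₁ ≠ p.eval c₂) (m : ℕ)
    (hle₁ : ∀ j ≤ m, ‖(fun x => p.eval x)^[j] c₁‖ ≤ R)
    (hle₂ : ∀ j ≤ m, ‖(fun x => p.eval x)^[j] c₂‖ ≤ R)
    (hlt₁ : R < ‖(fun x => p.eval x)^[m + 1] c₁‖) (hlt₂ : R < ‖(fun x => p.eval x)^[m + 1] c₂‖) :
    IsTotallyDisconnected (filledJulia fun x => p.eval x) := by
  set P : ℂ → ℂ := fun x => p.eval x with hPdef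
  have hP : Continuous P := p.continuous
  obtain ⟨hq, F, hFc, hF, hFs⟩ := exists_iterate_parametrization hR hgrow m (fun c h0 => by
    rcases hc c h0 with rfl | rfl
    exacts [hle₁, hle₂])
  have hlt : ∀ {z : ℂ}, ‖P (P^[m] z)‖ ≤ R → ‖P^[m] z‖ < R := by
    intro z hz
    by_contra! h
    linarith [hgrow _ h]
  have hb : ∀ {z : ℂ}, ‖P^[m] z‖ ≤ R → ‖z‖ ≤ R := by
    intro z hz
    by_contra! h
    linarith [norm_le_norm_iterate hgrow h.le m]
  set S : Set ℂ := {z | ‖P^[m] z‖ < R} with hSdef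
  set T : Set ℂ := {z | ‖P (P^[m] z)‖ ≤ R} with hTdef
  have hS : IsOpen S := isOpen_lt (hP.iterate m).norm continuous_const
  have hcS : ∀ c, p.derivative.eval c = 0 → p.eval c ∉ S := by
    intro c h0 h
    have h : ‖P^[m + 1] c‖ < R := h
    rcases hc c h0 with rfl | rfl <;> linarith
  refine isTotallyDisconnected_of_branches (S := S) (T := T) hS ?_ ?_ (fun z hz => hlt hz) ?_ ?_
    (mapsTo_filledJulia hR hgrow) hcS fun x₀ hx₀ => exists_branch hS ?_ hcS hx₀
  · exact (Metric.isBounded_closedBall (x := (0 : ℂ)) (r := R)).subset fun z hz =>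
      mem_closedBall_zero_iff.2 (hb (le_of_lt hz))
  · refine Metric.isCompact_of_isClosed_isBounded
      (isClosed_le (hP.comp (hP.iterate m)).norm continuous_const) ?_
    exact (Metric.isBounded_closedBall (x := (0 : ℂ)) (r := R)).subset fun z hz =>
      mem_closedBall_zero_iff.2 (hb (hlt hz).le)
  · intro z hz
    have hz : ‖P^[m] (P z)‖ < R := hz
    rw [← Function.iterate_succ_apply, Function.iterate_succ_apply'] at hz
    exact hz.le
  · intro z hz
    have := (mem_filledJulia_iff_le hR hgrow).1 hz (m + 1)
    rwa [Function.iterate_succ_apply'] at this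
  · refine hasLifts_of_exterior_parametrization (ρ := R + 1) hR hq (fun w hw => ?_) (fun w hw => ?_)
      hFc hF hFs hc hne ?_ ?_
    · rw [eval_iterate_comp_X]; exact le_of_lt hw
    · linarith [hb (le_of_lt hw)]
    · rw [eval_iterate_comp_X]; exact hlt₁
    · rw [eval_iterate_comp_X]; exact hlt₂

/-- For a cubic with non-negative coefficients and leading coefficient at least `1`, the norm at
least doubles outside a disc. -/
theorem two_mul_norm_le_norm_cubic {a₁ a₂ a₃ : ℝ} (h₁ : 0 ≤ a₁) (h₂ : 0 ≤ a₂) (h₃ : 1 ≤ a₃) {z : ℂ}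
    (hz : a₁ + a₂ + 2 ≤ ‖z‖) :
    2 * ‖z‖ ≤ ‖(a₁ : ℂ) * z + a₂ * z ^ 2 + a₃ * z ^ 3‖ := by
  have e : (a₃ : ℂ) * z ^ 3 = ((a₁ : ℂ) * z + a₂ * z ^ 2 + a₃ * z ^ 3) - a₁ * z - a₂ * z ^ 2 := by
    ring
  have hn := congrArg norm e
  have t1 := norm_sub_le (((a₁ : ℂ) * z + a₂ * z ^ 2 + a₃ * z ^ 3) - a₁ * z) (a₂ * z ^ 2)
  have t2 := norm_sub_le ((a₁ : ℂ) * z + a₂ * z ^ 2 + a₃ * z ^ 3) (a₁ * z)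
  rw [← hn] at t1
  simp only [norm_mul, norm_pow, Complex.norm_real, Real.norm_of_nonneg h₁, Real.norm_of_nonneg h₂,
    Real.norm_of_nonneg (zero_le_one.trans h₃)] at t1 t2
  have hr : 0 ≤ ‖z‖ := norm_nonneg z
  have k1 : ‖z‖ ^ 3 ≤ a₃ * ‖z‖ ^ 3 := le_mul_of_one_le_left (by positivity) h₃
  have k2 : 2 ≤ ‖z‖ ^ 2 - a₂ * ‖z‖ - a₁ := by nlinarith
  have k3 := mul_le_mul_of_nonneg_left k2 hr
  nlinarith

/-- A real polynomial map commutes with complex conjugation, and so do its iterates. -/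
theorem norm_iterate_conj {P : ℂ → ℂ} (hP : ∀ z, P (starRingEnd ℂ z) = starRingEnd ℂ (P z)) (j : ℕ)
    (z : ℂ) : ‖P^[j] (starRingEnd ℂ z)‖ = ‖P^[j] z‖ := by
  have h : Function.Semiconj (starRingEnd ℂ) P P := fun w => (hP w).symm
  rw [← (h.iterate_right j).eq, RCLike.norm_conj]

end PolynomialJulia

open PolynomialJulia

/-- If `a₁, a₂, a₃` are positive integers with `a₂² < 3·a₁·a₃`, then the
Julia set of `P(z) = a₁z + a₂z² + a₃z³` is either connected or totally disconnected. -/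
theorem stmt_14 (a₁ a₂ a₃ : ℕ)
    (h₁ : 0 < a₁) (h₂ : 0 < a₂) (h₃ : 0 < a₃)
    (hcond : a₂ ^ 2 < 3 * a₁ * a₃)
    (P : ℂ → ℂ)
    (hP : ∀ z, P z = a₁ * z + a₂ * z ^ 2 + a₃ * z ^ 3) :
    IsConnected
        (frontier {z : ℂ | Bornology.IsBounded (Set.range fun n => P^[n] z)}) ∨
      IsTotallyDisconnected
        (frontier {z : ℂ | Bornology.IsBounded (Set.range fun n => P^[n] z)}) := by
  change IsConnected (frontier (filledJulia P)) ∨ IsTotallyDisconnected (frontier (filledJulia P))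
  obtain ⟨p, hp⟩ : ∃ p : Polynomial ℂ, p = Polynomial.C (a₁ : ℂ) * Polynomial.X +
    Polynomial.C (a₂ : ℂ) * Polynomial.X ^ 2 + Polynomial.C (a₃ : ℂ) * Polynomial.X ^ 3 := ⟨_, rfl⟩
  obtain rfl : P = fun x => p.eval x := by
    funext z
    simp [hP, hp]
  have hP : ∀ z, p.eval z = a₁ * z + a₂ * z ^ 2 + a₃ * z ^ 3 := hP
  have hd : ∀ z, p.derivative.eval z = a₁ + 2 * a₂ * z + 3 * a₃ * z ^ 2 := by
    intro z
    simp [hp]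
    ring
  clear hp
  obtain ⟨R, hRdef⟩ : ∃ R : ℝ, R = a₁ + a₂ + 2 := ⟨_, rfl⟩
  have hR : 0 < R := by rw [hRdef]; positivity
  have hgrow : ∀ z, R ≤ ‖z‖ → 2 * ‖z‖ ≤ ‖p.eval z‖ := by
    intro z hz
    rw [hP]
    exact_mod_cast two_mul_norm_le_norm_cubic (Nat.cast_nonneg a₁) (Nat.cast_nonneg a₂)
      (Nat.one_le_cast.2 h₃) (hRdef ▸ hz)
  have hA₁ : (1 : ℝ) ≤ a₁ := Nat.one_le_cast.2 h₁
  have hA₃ : (1 : ℝ) ≤ a₃ := Nat.one_le_cast.2 h₃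
  have hpos : (0 : ℝ) < 3 * a₁ * a₃ - a₂ ^ 2 := by
    have : (a₂ : ℝ) ^ 2 < 3 * a₁ * a₃ := by exact_mod_cast hcond
    linarith
  obtain ⟨D, hD, hDsq⟩ : ∃ D : ℝ, 0 < D ∧ D ^ 2 = 3 * a₁ * a₃ - a₂ ^ 2 :=
    ⟨_, Real.sqrt_pos.2 hpos, Real.sq_sqrt hpos.le⟩
  have hDsq' : (D : ℂ) ^ 2 = 3 * a₁ * a₃ - a₂ ^ 2 := by exact_mod_cast congrArg Complex.ofReal hDsq
  have ha₃ : (a₃ : ℂ) ≠ 0 := by exact_mod_cast h₃.ne'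
  have hI := Complex.I_sq
  obtain ⟨c, hc⟩ : ∃ c : ℂ, c = (-a₂ + D * Complex.I) / (3 * a₃) := ⟨_, rfl⟩
  have hc' : starRingEnd ℂ c = (-a₂ - D * Complex.I) / (3 * a₃) := by
    rw [hc]
    simp [sub_eq_add_neg, map_ofNat]
  have hsum : c + starRingEnd ℂ c = -2 * a₂ / (3 * a₃) := by
    rw [hc', hc]
    ring
  have hprod : c * starRingEnd ℂ c = a₁ / (3 * a₃) := by
    rw [hc', hc]
    field_simp
    linear_combination (-D ^ 2) * hI + hDsq'
  have hcrit : ∀ z, p.derivative.eval z = 0 → z = c ∨ z = starRingEnd ℂ c := by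
    intro z hz
    have h : 3 * (a₃ : ℂ) * ((z - c) * (z - starRingEnd ℂ c)) = 0 := by
      have e : (z - c) * (z - starRingEnd ℂ c) =
          z ^ 2 - (c + starRingEnd ℂ c) * z + c * starRingEnd ℂ c := by ring
      rw [e, hsum, hprod, ← hz, hd]
      field_simp
      ring
    simpa [ha₃, sub_eq_zero] using h
  have hcR : ‖c‖ ≤ R := by
    have h : ‖c‖ ^ 2 = a₁ / (3 * a₃) := by
      rw [← Complex.normSq_eq_norm_sq]
      rw [Complex.mul_conj] at hprod
      refine Complex.ofReal_injective (hprod.trans ?_)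
      push_cast
      rfl
    have h' : (a₁ : ℝ) / (3 * a₃) ≤ a₁ := div_le_self (by positivity) (by linarith)
    have : (0 : ℝ) ≤ a₂ := Nat.cast_nonneg _
    nlinarith [norm_nonneg c]
  have hne : p.eval c ≠ p.eval (starRingEnd ℂ c) := by
    intro h
    have hDc : (D : ℂ) ≠ 0 := by exact_mod_cast hD.ne'
    have e : p.eval c - p.eval (starRingEnd ℂ c) =
        (c - starRingEnd ℂ c) * (a₁ + a₂ * (c + starRingEnd ℂ c) +
          a₃ * ((c + starRingEnd ℂ c) ^ 2 - c * starRingEnd ℂ c)) := by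
      rw [hP, hP]
      ring
    have e' : (a₁ : ℂ) + a₂ * (-2 * a₂ / (3 * a₃)) +
        a₃ * ((-2 * a₂ / (3 * a₃)) ^ 2 - a₁ / (3 * a₃)) = 2 * D ^ 2 / (9 * a₃) := by
      rw [hDsq']
      field_simp
      ring
    have e'' : c - starRingEnd ℂ c = 2 * D * Complex.I / (3 * a₃) := by
      rw [hc', hc]
      ring
    rw [h, sub_self, hsum, hprod, e', e''] at e
    simp [ha₃, hDc] at e
  have hconj : ∀ j, ‖(fun x => p.eval x)^[j] (starRingEnd ℂ c)‖ = ‖(fun x => p.eval x)^[j] c‖ :=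
    fun j => norm_iterate_conj (fun z => by simp [hP]) j c
  by_cases hall : ∀ j, ‖(fun x => p.eval x)^[j] c‖ ≤ R
  · refine Or.inl ⟨?_, isPreconnected_frontier_filledJulia hR hgrow fun z hz j => ?_⟩
    · rw [nonempty_frontier_iff]
      refine ⟨⟨0, ?_⟩, fun hu => ?_⟩
      · have h0 : ∀ n, (fun x => p.eval x)^[n] 0 = 0 :=
          fun n => Function.iterate_fixed (by simp [hP]) n
        simp [filledJulia, h0]
      · have hmem : ((R + 1 : ℝ) : ℂ) ∈ filledJulia fun x => p.eval x := hu ▸ Set.mem_univ _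
        have := filledJulia_subset_closedBall hR hgrow hmem
        rw [mem_closedBall_zero_iff, Complex.norm_real, Real.norm_of_nonneg (by linarith)] at this
        linarith
    · rcases hcrit z hz with rfl | rfl
      · exact hall j
      · exact (hconj j).trans_le (hall j)
  · push Not at hall
    classical
    obtain ⟨m, hm⟩ : ∃ m, Nat.find hall = m + 1 := by
      refine Nat.exists_eq_succ_of_ne_zero fun h => ?_
      have := Nat.find_spec hall
      rw [h] at this
      exact this.not_ge hcR
    have hlt := Nat.find_spec hall
    rw [hm] at hlt
    have hle : ∀ j ≤ m, ‖(fun x => p.eval x)^[j] c‖ ≤ R :=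
      fun j hj => not_lt.1 (Nat.find_min hall (by omega))
    have htd := isTotallyDisconnected_filledJulia hR hgrow hcrit hne m hle
      (fun j hj => (hconj j).trans_le (hle j hj)) hlt (hlt.trans_eq (hconj _).symm)
    have hsub := (isClosed_filledJulia p.continuous hR hgrow).frontier_subset
    exact Or.inr fun t ht hpre => htd t (ht.trans hsub) hpre
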